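/- Let m be an odd positive integer, y_0,...,y_{(m-1)/2} ∈ {0,1} with ∑_k y_k = 1, z ∈ {0,1}, and x a real number. If -∑_k (2k+1)·y_k ≤ x ≤ ∑_k (2k+1)·y_k, ∑_k (2k+1)·y_k - x ≤ 2mz, and ∑_k (2k+1)·y_k + x ≤ 2m(1-z), then x is an odd integer with -m ≤ x ≤ m, either x = ∑_k (2k+1)·y_k or x = -∑_k (2k+1)·y_k, and x² = ∑_k (2k+1)²·y_k. -/

import Mathlib

/-- Let `m` be an odd positive integer, `y_0, ..., y_{(m-1)/2} ∈ {0,1}` with `∑ y_k = 1`,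
`z ∈ {0,1}`, and `x` real. If `-∑ (2k+1)·y_k ≤ x ≤ ∑ (2k+1)·y_k`,
`∑ (2k+1)·y_k - x ≤ 2mz` and `∑ (2k+1)·y_k + x ≤ 2m(1-z)`, then `x` is an odd integer
with `-m ≤ x ≤ m`, `x = ±∑ (2k+1)·y_k`, and `x² = ∑ (2k+1)²·y_k`. -/
theorem stmt6 (m : ℕ) (hm : 0 < m) (hmodd : Odd m) (y : ℕ → ℝ) (z x : ℝ)
    (hy : ∀ k ∈ Finset.range ((m - 1) / 2 + 1), y k = 0 ∨ y k = 1)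
    (hysum : (∑ k ∈ Finset.range ((m - 1) / 2 + 1), y k) = 1)
    (hz : z = 0 ∨ z = 1)
    (h1 : -(∑ k ∈ Finset.range ((m - 1) / 2 + 1), (2 * (k : ℝ) + 1) * y k) ≤ x)
    (h2 : x ≤ ∑ k ∈ Finset.range ((m - 1) / 2 + 1), (2 * (k : ℝ) + 1) * y k)
    (h3 : (∑ k ∈ Finset.range ((m - 1) / 2 + 1), (2 * (k : ℝ) + 1) * y k) - x ≤ 2 * m * z)
    (h4 : (∑ k ∈ Finset.range ((m - 1) / 2 + 1), (2 * (k : ℝ) + 1) * y k) + x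
        ≤ 2 * m * (1 - z)) :
    (∃ t : ℤ, Odd t ∧ x = (t : ℝ)) ∧ -(m : ℝ) ≤ x ∧ x ≤ (m : ℝ) ∧
    (x = ∑ k ∈ Finset.range ((m - 1) / 2 + 1), (2 * (k : ℝ) + 1) * y k ∨
      x = -(∑ k ∈ Finset.range ((m - 1) / 2 + 1), (2 * (k : ℝ) + 1) * y k)) ∧
    x ^ 2 = ∑ k ∈ Finset.range ((m - 1) / 2 + 1), (2 * (k : ℝ) + 1) ^ 2 * y k := by
  have hex : ∃ j ∈ Finset.range ((m - 1) / 2 + 1), y j = 1 := by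
    by_contra hcon
    push Not at hcon
    have h0 : (∑ k ∈ Finset.range ((m - 1) / 2 + 1), y k) = 0 :=
      Finset.sum_eq_zero fun k hk => (hy k hk).resolve_right (hcon k hk)
    linarith
  obtain ⟨j, hj, hyj⟩ := hex
  have hE : (∑ k ∈ (Finset.range ((m - 1) / 2 + 1)).erase j, y k) = 0 := by
    have := Finset.add_sum_erase _ y hj
    linarith
  have hnn : ∀ k ∈ (Finset.range ((m - 1) / 2 + 1)).erase j, 0 ≤ y k := by
    intro k hk
    rcases hy k (Finset.mem_of_mem_erase hk) with h | h <;> rw [h] <;> norm_num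
  have hz0 := (Finset.sum_eq_zero_iff_of_nonneg hnn).1 hE
  have key : ∀ f : ℕ → ℝ, (∑ k ∈ Finset.range ((m - 1) / 2 + 1), f k * y k) = f j := by
    intro f
    rw [Finset.sum_eq_single_of_mem j hj, hyj, mul_one]
    intro k hk hkj
    rw [hz0 k (Finset.mem_erase.2 ⟨hkj, hk⟩), mul_zero]
  rw [key (fun k => 2 * (k : ℝ) + 1)] at h1 h2 h3 h4 ⊢
  rw [key (fun k => (2 * (k : ℝ) + 1) ^ 2)]
  have hjm : 2 * j + 1 ≤ m := by
    have := Finset.mem_range.1 hj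
    omega
  have hjm' : 2 * (j : ℝ) + 1 ≤ m := by exact_mod_cast hjm
  have hj0 : (0 : ℝ) ≤ j := Nat.cast_nonneg j
  have hx : x = 2 * (j : ℝ) + 1 ∨ x = -(2 * (j : ℝ) + 1) := by
    rcases hz with rfl | rfl
    · left; linarith
    · right; linarith
  refine ⟨?_, by linarith, by linarith, hx, ?_⟩
  · rcases hx with h | h
    · exact ⟨2 * j + 1, ⟨j, rfl⟩, by rw [h]; push_cast; ring⟩
    · exact ⟨-(2 * j + 1), Odd.neg ⟨j, rfl⟩, by rw [h]; push_cast; ring⟩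
  · rcases hx with h | h <;> rw [h]
    ring
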